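/- arXiv:1806.01364 — 3 statements merged into one kernel-verified Lean document; each statement's English description precedes it below -/
import Mathlib

section
/- Existence for the Schrödinger system (Fortet). Let n ≥ 1 and let g : ℝⁿ × ℝⁿ → ℝ be a continuous, nonnegative function that is bounded above, such that for each fixed x the set {y : g(x,y) = 0} has Lebesgue measure zero, and for each fixed y the set {x : g(x,y) = 0} has Lebesgue measure zero. Let ρ₀, ρ₁ : ℝⁿ → ℝ be continuous, nonnegative, Lebesgue-integrable functions with ∫ ρ₀(x) dx = ∫ ρ₁(y) dy, and assume that the integral ∫ ρ₁(y) / (∫ g(z,y) ρ₀(z) dz) dy is finite. Then there exist a nonnegative continuous function φ : ℝⁿ → ℝ and a nonnegative measurable function ψ : ℝⁿ → ℝ such that φ(x) ∫ g(x,y) ψ(y) dy = ρ₀(x) for all x and ψ(y) ∫ g(x,y) φ(x) dx = ρ₁(y) for almost every y; moreover φ(x) = 0 only at points where ρ₀(x) = 0, and ψ(y) = 0 only at points (up to a null set) where ρ₁(y) = 0. -/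
open MeasureTheory Real

namespace SchroedingerSystem

open Filter Topology
open scoped ENNReal

variable {α β : Type*} [MeasurableSpace α] (μ : Measure α)
  (K : α → β → ℝ≥0∞) (r₀ : α → ℝ≥0∞) (r₁ : β → ℝ≥0∞)

/-- The integral of the kernel against the factor `r₀ / h`. -/
noncomputable def denominator (h : α → ℝ≥0∞) (y : β) : ℝ≥0∞ := ∫⁻ x, K x y * (r₀ x / h x) ∂μ

/-- The second factor of the Schrödinger system determined by the first factor `r₀ / h`. -/
noncomputable def factor (h : α → ℝ≥0∞) (y : β) : ℝ≥0∞ := r₁ y / denominator μ K r₀ h y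

variable {μ K r₀ r₁} {h h' : α → ℝ≥0∞}

lemma denominator_anti (hh : h ≤ h') : denominator μ K r₀ h' ≤ denominator μ K r₀ h :=
  fun _ ↦ lintegral_mono fun x ↦ mul_le_mul_right (ENNReal.div_le_div_left (hh x) _) _

lemma factor_mono (hh : h ≤ h') : factor μ K r₀ r₁ h ≤ factor μ K r₀ r₁ h' :=
  fun y ↦ ENNReal.div_le_div_left (denominator_anti hh y) _

variable [MeasurableSpace β] {ν : Measure β}

variable (μ ν K r₀ r₁) in
/-- Fortet's map, whose fixed points `h` yield the solution `(r₀ / h, factor h)`. -/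
noncomputable def fortetMap (h : α → ℝ≥0∞) (x : α) : ℝ≥0∞ :=
  ∫⁻ y, K x y * factor μ K r₀ r₁ h y ∂ν

lemma fortetMap_mono (hh : h ≤ h') : fortetMap μ K r₀ r₁ ν h ≤ fortetMap μ K r₀ r₁ ν h' :=
  fun _ ↦ lintegral_mono fun y ↦ mul_le_mul_right (factor_mono hh y) _

lemma measurable_denominator [SFinite μ] (hK : Measurable (Function.uncurry K))
    (hr₀ : Measurable r₀) (hh : Measurable h) : Measurable (denominator μ K r₀ h) := by
  refine Measurable.lintegral_prod_left (f := fun x y ↦ K x y * (r₀ x / h x)) ?_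
  exact hK.mul ((hr₀.comp measurable_fst).div (hh.comp measurable_fst))

lemma measurable_factor [SFinite μ] (hK : Measurable (Function.uncurry K))
    (hr₀ : Measurable r₀) (hr₁ : Measurable r₁) (hh : Measurable h) :
    Measurable (factor μ K r₀ r₁ h) :=
  hr₁.div (measurable_denominator hK hr₀ hh)

lemma measurable_fortetMap [SFinite μ] [SFinite ν] (hK : Measurable (Function.uncurry K))
    (hr₀ : Measurable r₀) (hr₁ : Measurable r₁) (hh : Measurable h) :
    Measurable (fortetMap μ K r₀ r₁ ν h) := by
  refine Measurable.lintegral_prod_right (f := fun x y ↦ K x y * factor μ K r₀ r₁ h y) ?_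
  exact hK.mul ((measurable_factor hK hr₀ hr₁ hh).comp measurable_snd)

lemma lintegral_div_mul_fortetMap [SFinite μ] [SFinite ν] (hK : Measurable (Function.uncurry K))
    (hr₀ : Measurable r₀) (hr₁ : Measurable r₁) (hh : Measurable h) :
    ∫⁻ x, r₀ x / h x * fortetMap μ K r₀ r₁ ν h x ∂μ
      = ∫⁻ y, factor μ K r₀ r₁ h y * denominator μ K r₀ h y ∂ν := by
  have hψ := measurable_factor (μ := μ) hK hr₀ hr₁ hh
  have hKx : ∀ x, Measurable (K x) := fun x ↦ hK.comp measurable_prodMk_left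
  have hKy : ∀ y, Measurable fun x ↦ K x y := fun y ↦ hK.comp measurable_prodMk_right
  calc _ = ∫⁻ x, ∫⁻ y, r₀ x / h x * (K x y * factor μ K r₀ r₁ h y) ∂ν ∂μ := by
        refine lintegral_congr fun x ↦ ?_
        exact (lintegral_const_mul _ ((hKx x).mul hψ)).symm
    _ = ∫⁻ y, ∫⁻ x, r₀ x / h x * (K x y * factor μ K r₀ r₁ h y) ∂μ ∂ν := by
        refine lintegral_lintegral_swap (Measurable.aemeasurable ?_)
        exact ((hr₀.div hh).comp measurable_fst).mul (hK.mul (hψ.comp measurable_snd))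
    _ = _ := by
        refine lintegral_congr fun y ↦ ?_
        refine Eq.trans ?_ (lintegral_const_mul _ ((hKy y).mul (hr₀.div hh)))
        exact lintegral_congr fun x ↦ by ring

lemma fortetMap_le {M : ℝ≥0∞} (hM : M ≠ ∞) (hKM : ∀ x y, K x y ≤ M) (x : α) :
    fortetMap μ K r₀ r₁ ν h x ≤ M * ∫⁻ y, factor μ K r₀ r₁ h y ∂ν := by
  rw [← lintegral_const_mul' _ _ hM]
  exact lintegral_mono fun y ↦ mul_le_mul_left (hKM x y) _

lemma fortetMap_ne_zero [SFinite μ] (hK : Measurable (Function.uncurry K))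
    (hr₀ : Measurable r₀) (hr₁ : Measurable r₁) (hh : Measurable h)
    (hKx : ∀ x, ∀ᵐ y ∂ν, K x y ≠ 0) (hψ : ∫⁻ y, factor μ K r₀ r₁ h y ∂ν ≠ 0) (x : α) :
    fortetMap μ K r₀ r₁ ν h x ≠ 0 := by
  have hm := measurable_factor (μ := μ) hK hr₀ hr₁ hh
  intro h0
  replace h0 := (lintegral_eq_zero_iff ((hK.comp measurable_prodMk_left).mul hm)).1 h0
  refine hψ ((lintegral_eq_zero_iff hm).2 ?_)
  filter_upwards [h0, hKx x] with y hy hKy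
  exact (mul_eq_zero.1 hy).resolve_left hKy

lemma denominator_ne_zero (hK : Measurable (Function.uncurry K))
    (hr₀ : Measurable r₀) (hh : Measurable h) (hh1 : h ≤ 1)
    (hKy : ∀ y, ∀ᵐ x ∂μ, K x y ≠ 0) (h0 : ∫⁻ x, r₀ x ∂μ ≠ 0) (y : β) :
    denominator μ K r₀ h y ≠ 0 := by
  intro hD
  replace hD :=
    (lintegral_eq_zero_iff ((hK.comp measurable_prodMk_right).mul (hr₀.div hh))).1 hD
  refine h0 ((lintegral_eq_zero_iff hr₀).2 ?_)
  filter_upwards [hD, hKy y] with x hx hKx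
  have := (mul_eq_zero.1 hx).resolve_left hKx
  exact (ENNReal.div_eq_zero_iff.1 this).resolve_right ((hh1 x).trans_lt ENNReal.one_lt_top).ne

section Convergence

variable {u : ℕ → α → ℝ≥0∞}

lemma tendsto_denominator (hK : Measurable (Function.uncurry K)) (hr₀ : Measurable r₀)
    (hr₀_top : ∀ x, r₀ x ≠ ∞) (hu : ∀ k, Measurable (u k)) (hanti : Antitone u)
    (hlim : ∀ x, Tendsto (fun k ↦ u k x) atTop (𝓝 (h x))) (y : β) :
    Tendsto (fun k ↦ denominator μ K r₀ (u k) y) atTop (𝓝 (denominator μ K r₀ h y)) := by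
  have hKy : Measurable fun x ↦ K x y := hK.comp measurable_prodMk_right
  have hmono : ∀ x, Monotone fun k ↦ K x y * (r₀ x / u k x) := fun x i j hij ↦
    mul_le_mul_right (ENNReal.div_le_div_left (hanti hij x) _) _
  have hsup : ∀ x, ⨆ k, K x y * (r₀ x / u k x) = K x y * (r₀ x / h x) := fun x ↦ by
    rw [← ENNReal.mul_iSup]
    congr 1
    exact iSup_eq_of_tendsto (fun i j hij ↦ ENNReal.div_le_div_left (hanti hij x) _)
      (ENNReal.Tendsto.const_div (hlim x) (Or.inr (hr₀_top x)))
  refine lintegral_tendsto_of_tendsto_of_monotone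
    (fun k ↦ (hKy.mul (hr₀.div (hu k))).aemeasurable) (ae_of_all _ hmono) (ae_of_all _ fun x ↦ ?_)
  rw [← hsup x]
  exact tendsto_atTop_iSup (hmono x)

lemma tendsto_factor (hK : Measurable (Function.uncurry K)) (hr₀ : Measurable r₀)
    (hr₀_top : ∀ x, r₀ x ≠ ∞) (hr₁_top : ∀ y, r₁ y ≠ ∞) (hu : ∀ k, Measurable (u k))
    (hanti : Antitone u) (hlim : ∀ x, Tendsto (fun k ↦ u k x) atTop (𝓝 (h x))) (y : β) :
    Tendsto (fun k ↦ factor μ K r₀ r₁ (u k) y) atTop (𝓝 (factor μ K r₀ r₁ h y)) :=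
  ENNReal.Tendsto.const_div (tendsto_denominator hK hr₀ hr₀_top hu hanti hlim y)
    (Or.inr (hr₁_top y))

lemma tendsto_lintegral_factor [SFinite μ] (hK : Measurable (Function.uncurry K))
    (hr₀ : Measurable r₀) (hr₁ : Measurable r₁) (hr₀_top : ∀ x, r₀ x ≠ ∞) (hr₁_top : ∀ y, r₁ y ≠ ∞)
    (hu : ∀ k, Measurable (u k)) (hanti : Antitone u)
    (hlim : ∀ x, Tendsto (fun k ↦ u k x) atTop (𝓝 (h x)))
    (hfin : ∫⁻ y, factor μ K r₀ r₁ (u 0) y ∂ν ≠ ∞) {L : β → ℝ≥0∞} (hL : Measurable L)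
    {M : ℝ≥0∞} (hM : M ≠ ∞) (hLM : ∀ y, L y ≤ M) :
    Tendsto (fun k ↦ ∫⁻ y, L y * factor μ K r₀ r₁ (u k) y ∂ν) atTop
      (𝓝 (∫⁻ y, L y * factor μ K r₀ r₁ h y ∂ν)) := by
  refine lintegral_tendsto_of_tendsto_of_antitone
    (fun k ↦ (hL.mul (measurable_factor hK hr₀ hr₁ (hu k))).aemeasurable)
    (ae_of_all _ fun y i j hij ↦ mul_le_mul_right (factor_mono (hanti hij) y) _) ?_
    (ae_of_all _ fun y ↦ ENNReal.Tendsto.const_mul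
      (tendsto_factor hK hr₀ hr₀_top hr₁_top hu hanti hlim y)
      (Or.inr ((hLM y).trans_lt hM.lt_top).ne))
  refine ((lintegral_mono fun y ↦ mul_le_mul_left (hLM y) _).trans_lt ?_).ne
  rw [lintegral_const_mul' _ _ hM]
  exact ENNReal.mul_lt_top hM.lt_top hfin.lt_top

end Convergence

variable (μ ν K r₀ r₁) in
/-- Fortet's iteration, truncated above by `1` and below by a vanishing sequence. -/
noncomputable def iterate : ℕ → α → ℝ≥0∞
  | 0 => 1
  | k + 1 => fun x ↦ max ((k + 1 : ℕ) : ℝ≥0∞)⁻¹ (min (fortetMap μ K r₀ r₁ ν (iterate k) x) 1)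

local notation "U" => iterate μ K r₀ r₁ ν

lemma measurable_iterate [SFinite μ] [SFinite ν] (hK : Measurable (Function.uncurry K))
    (hr₀ : Measurable r₀) (hr₁ : Measurable r₁) (k : ℕ) : Measurable (U k) := by
  induction k with
  | zero => exact measurable_const
  | succ k ih =>
    exact measurable_const.max ((measurable_fortetMap hK hr₀ hr₁ ih).min measurable_const)

lemma iterate_le_one (k : ℕ) : U k ≤ 1 := by
  cases k with
  | zero => exact le_rfl
  | succ k =>
    exact fun x ↦ max_le (ENNReal.inv_le_one.2 (by exact_mod_cast k.succ_pos)) (min_le_right _ _)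

lemma antitone_iterate : Antitone U := by
  refine antitone_nat_of_succ_le fun k ↦ ?_
  induction k with
  | zero => exact iterate_le_one 1
  | succ k ih =>
    refine fun x ↦ max_le_max (ENNReal.inv_le_inv.2 ?_) (min_le_min_right _ (fortetMap_mono ih x))
    exact_mod_cast Nat.le_succ _

lemma exists_le_iterate (k : ℕ) : ∃ ε : ℝ≥0∞, ε ≠ 0 ∧ ∀ x, ε ≤ U k x := by
  cases k with
  | zero => exact ⟨1, one_ne_zero, fun x ↦ le_rfl⟩
  | succ k => exact ⟨_, ENNReal.inv_ne_zero.2 (ENNReal.natCast_ne_top _), fun x ↦ le_max_left _ _⟩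

lemma eq_of_div_mul_eq {a b c : ℝ≥0∞} (ha : a ≠ 0) (ha' : a ≠ ∞) (hb : b ≠ 0) (hb' : b ≠ ∞)
    (h : a / b * c = a) : c = b :=
  (ENNReal.mul_right_inj (ENNReal.div_ne_zero.2 ⟨ha, hb'⟩) (ENNReal.div_ne_top ha' hb)).1
    (h.trans (ENNReal.div_mul_cancel hb hb').symm)

/-- Fortet's map has a fixed point bounded by `1`. -/
theorem exists_fixedPoint [SFinite μ] [SFinite ν] (hK : Measurable (Function.uncurry K))
    (hr₀ : Measurable r₀) (hr₁ : Measurable r₁) (hr₀_top : ∀ x, r₀ x ≠ ∞) (hr₁_top : ∀ y, r₁ y ≠ ∞)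
    {M : ℝ≥0∞} (hM : M ≠ ∞) (hKM : ∀ x y, K x y ≤ M)
    (hKx : ∀ x, ∀ᵐ y ∂ν, K x y ≠ 0) (hKy : ∀ y, ∀ᵐ x ∂μ, K x y ≠ 0)
    (hmass : ∫⁻ x, r₀ x ∂μ = ∫⁻ y, r₁ y ∂ν) (h0 : ∫⁻ x, r₀ x ∂μ ≠ 0) (h_top : ∫⁻ x, r₀ x ∂μ ≠ ∞)
    (hfin : ∫⁻ y, factor μ K r₀ r₁ 1 y ∂ν ≠ ∞) :
    ∃ h : α → ℝ≥0∞, Measurable h ∧ h ≤ 1 ∧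
      (∀ᵐ x ∂μ, r₀ x ≠ 0 → fortetMap μ K r₀ r₁ ν h x = h x) ∧
      (∀ᵐ y ∂ν, r₁ y ≠ 0 → denominator μ K r₀ h y ≠ ∞) := by
  by_cases hcase : ∃ k, ∀ x, fortetMap μ K r₀ r₁ ν (U k) x ≤ 1
  · obtain ⟨k, hk⟩ := hcase
    have hm := measurable_iterate (μ := μ) (ν := ν) hK hr₀ hr₁ k
    obtain ⟨ε, hε, hεU⟩ := exists_le_iterate (μ := μ) (ν := ν) (K := K) (r₀ := r₀) (r₁ := r₁) k
    have hU0 : ∀ x, U k x ≠ 0 := fun x ↦ ((pos_iff_ne_zero.2 hε).trans_le (hεU x)).ne'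
    have hUtop : ∀ x, U k x ≠ ∞ := fun x ↦ ((iterate_le_one k x).trans_lt ENNReal.one_lt_top).ne
    have hsuper : ∀ x, fortetMap μ K r₀ r₁ ν (U k) x ≤ U k x := fun x ↦
      (le_min le_rfl (hk x)).trans ((le_max_right _ _).trans (antitone_iterate k.le_succ x))
    have hD : ∀ y, denominator μ K r₀ (U k) y ≠ ∞ := fun y ↦ by
      have hle : denominator μ K r₀ (U k) y ≤ ∫⁻ x, M * ε⁻¹ * r₀ x ∂μ :=
        lintegral_mono fun x ↦ by
          rw [mul_assoc, mul_comm ε⁻¹, ← div_eq_mul_inv]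
          exact mul_le_mul' (hKM x y) (ENNReal.div_le_div_left (hεU x) _)
      refine (hle.trans_lt ?_).ne
      have hc : M * ε⁻¹ ≠ ∞ := ENNReal.mul_ne_top hM (ENNReal.inv_ne_top.2 hε)
      rw [lintegral_const_mul' _ _ hc]
      exact ENNReal.mul_lt_top hc.lt_top h_top.lt_top
    have hbal : ∫⁻ x, r₀ x / U k x * fortetMap μ K r₀ r₁ ν (U k) x ∂μ = ∫⁻ x, r₀ x ∂μ := by
      rw [lintegral_div_mul_fortetMap hK hr₀ hr₁ hm, hmass]
      exact lintegral_congr fun y ↦ ENNReal.div_mul_cancel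
        (denominator_ne_zero hK hr₀ hm (iterate_le_one k) hKy h0 y) (hD y)
    have hle : ∀ x, r₀ x / U k x * fortetMap μ K r₀ r₁ ν (U k) x ≤ r₀ x := fun x ↦
      (mul_le_mul_right (hsuper x) _).trans_eq (ENNReal.div_mul_cancel (hU0 x) (hUtop x))
    refine ⟨U k, hm, iterate_le_one k, ?_, ae_of_all _ fun y _ ↦ hD y⟩
    filter_upwards [ae_eq_of_ae_le_of_lintegral_le (ae_of_all _ hle) (hbal.trans_ne h_top)
      hr₀.aemeasurable hbal.ge] with x hx hx0
    exact eq_of_div_mul_eq hx0 (hr₀_top x) (hU0 x) (hUtop x) hx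
  · push Not at hcase
    have hm : ∀ k, Measurable (U k) := measurable_iterate hK hr₀ hr₁
    set h : α → ℝ≥0∞ := fun x ↦ ⨅ k, U k x with hh
    have hhm : Measurable h := Measurable.iInf hm
    have hhU : ∀ k, h ≤ U k := fun k x ↦ iInf_le _ k
    have hh1 : h ≤ 1 := hhU 0
    have hlim : ∀ x, Tendsto (fun k ↦ U k x) atTop (𝓝 (h x)) := fun x ↦
      tendsto_atTop_iInf fun i j hij ↦ antitone_iterate hij x
    have hψ : ∫⁻ y, factor μ K r₀ r₁ h y ∂ν ≠ 0 := by
      intro hψ0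
      have ht := tendsto_lintegral_factor (ν := ν) hK hr₀ hr₁ hr₀_top hr₁_top hm antitone_iterate
        hlim hfin (measurable_const (a := M)) hM fun _ ↦ le_rfl
      simp only [lintegral_const_mul' _ _ hM, hψ0, mul_zero] at ht
      have hge : (1 : ℝ≥0∞) ≤ 0 := ge_of_tendsto' ht fun k ↦ by
        obtain ⟨x, hx⟩ := hcase k
        exact hx.le.trans (fortetMap_le hM hKM x)
      exact absurd hge (by simp)
    have hΩ0 := fortetMap_ne_zero hK hr₀ hr₁ hhm hKx hψ
    have hhpos : ∀ x, h x ≠ 0 := fun x ↦ by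
      refine ((lt_min (pos_iff_ne_zero.2 (hΩ0 x)) one_pos).trans_le (le_iInf fun k ↦ ?_)).ne'
      cases k with
      | zero => exact min_le_right _ _
      | succ k => exact (min_le_min_right _ (fortetMap_mono (hhU k) x)).trans (le_max_right _ _)
    have hhtop : ∀ x, h x ≠ ∞ := fun x ↦ ((hh1 x).trans_lt ENNReal.one_lt_top).ne
    have hsub : ∀ x, h x ≤ fortetMap μ K r₀ r₁ ν h x := fun x ↦ by
      have ht := ((ENNReal.tendsto_inv_nat_nhds_zero.comp (tendsto_add_atTop_nat 1)).max
        (tendsto_lintegral_factor (ν := ν) hK hr₀ hr₁ hr₀_top hr₁_top hm antitone_iterate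
          hlim hfin (hK.comp (measurable_prodMk_left (x := x))) hM (hKM x)))
      rw [max_eq_right zero_le] at ht
      exact ge_of_tendsto' ht fun k ↦
        (hhU (k + 1) x).trans (max_le_max le_rfl (min_le_left _ _))
    have hψD : ∀ y, factor μ K r₀ r₁ h y * denominator μ K r₀ h y ≤ r₁ y := fun y ↦ by
      rw [mul_comm]; exact ENNReal.mul_div_le
    have hle : ∀ x, r₀ x ≤ r₀ x / h x * fortetMap μ K r₀ r₁ ν h x := fun x ↦
      (ENNReal.div_mul_cancel (hhpos x) (hhtop x)).symm.trans_le (mul_le_mul_right (hsub x) _)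
    have hbal := lintegral_div_mul_fortetMap (μ := μ) (ν := ν) hK hr₀ hr₁ hhm
    have hle₁ : ∫⁻ x, r₀ x / h x * fortetMap μ K r₀ r₁ ν h x ∂μ ≤ ∫⁻ x, r₀ x ∂μ := by
      rw [hbal, hmass]; exact lintegral_mono hψD
    have hle₂ : ∫⁻ y, r₁ y ∂ν ≤ ∫⁻ y, factor μ K r₀ r₁ h y * denominator μ K r₀ h y ∂ν := by
      rw [← hbal, ← hmass]; exact lintegral_mono hle
    refine ⟨h, hhm, hh1, ?_, ?_⟩
    · filter_upwards [ae_eq_of_ae_le_of_lintegral_le (ae_of_all _ hle) h_top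
        ((hr₀.div hhm).mul (measurable_fortetMap hK hr₀ hr₁ hhm)).aemeasurable hle₁] with x hx hx0
      exact eq_of_div_mul_eq hx0 (hr₀_top x) (hhpos x) (hhtop x) hx.symm
    · filter_upwards [ae_eq_of_ae_le_of_lintegral_le (ae_of_all _ hψD)
        (((lintegral_mono hψD).trans_lt (hmass ▸ h_top.lt_top)).ne)
        hr₁.aemeasurable hle₂] with y hy hy0 hyD
      simp [factor, hyD, hy0.symm] at hy

lemma lintegral_factor_ne_zero [SFinite μ] (hK : Measurable (Function.uncurry K))
    (hr₀ : Measurable r₀) (hr₁ : Measurable r₁) (hh : Measurable h)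
    (hD : ∀ᵐ y ∂ν, r₁ y ≠ 0 → denominator μ K r₀ h y ≠ ∞) (h0 : ∫⁻ y, r₁ y ∂ν ≠ 0) :
    ∫⁻ y, factor μ K r₀ r₁ h y ∂ν ≠ 0 := by
  intro hψ
  rw [lintegral_eq_zero_iff (measurable_factor hK hr₀ hr₁ hh)] at hψ
  refine h0 ((lintegral_eq_zero_iff hr₁).2 ?_)
  filter_upwards [hψ, hD] with y hy hDy
  by_contra hy0
  exact (ENNReal.div_eq_zero_iff.1 hy).elim hy0 (hDy hy0)

lemma integral_mul_toReal {k : α → ℝ} {w : α → ℝ≥0∞} (hk : Measurable k) (hk0 : ∀ x, 0 ≤ k x)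
    (hw : Measurable w) (hw_top : ∀ x, w x ≠ ∞) :
    ∫ x, k x * (w x).toReal ∂μ = (∫⁻ x, ENNReal.ofReal (k x) * w x ∂μ).toReal := by
  refine Eq.trans ?_ (integral_toReal (hk.ennreal_ofReal.mul hw).aemeasurable
    (ae_of_all _ fun x ↦ ENNReal.mul_lt_top ENNReal.ofReal_lt_top (hw_top x).lt_top))
  simp [ENNReal.toReal_ofReal (hk0 _)]

end SchroedingerSystem

open SchroedingerSystem in
/-- **Existence for the Schrödinger system (Fortet).** Given a continuous, nonnegative,
bounded kernel `g` on `ℝⁿ × ℝⁿ` whose zero set is slicewise Lebesgue-null, and continuous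
nonnegative integrable marginal densities `ρ₀`, `ρ₁` with equal total mass such that
`∫ ρ₁(y) / (∫ g(z,y) ρ₀(z) dz) dy < ∞`, there exist a nonnegative continuous `φ` and a
nonnegative measurable `ψ` solving the Schrödinger system, with `φ = 0` only where `ρ₀ = 0`
and (a.e.) `ψ = 0` only where `ρ₁ = 0`. -/
theorem fortet_existence_schroedinger_system {n : ℕ} (hn : 1 ≤ n)
    (g : EuclideanSpace ℝ (Fin n) → EuclideanSpace ℝ (Fin n) → ℝ)
    (hg_cont : Continuous (Function.uncurry g))
    (hg_nonneg : ∀ x y, 0 ≤ g x y)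
    (hg_bdd : ∃ M : ℝ, ∀ x y, g x y ≤ M)
    (hg_null_x : ∀ x, volume {y : EuclideanSpace ℝ (Fin n) | g x y = 0} = 0)
    (hg_null_y : ∀ y, volume {x : EuclideanSpace ℝ (Fin n) | g x y = 0} = 0)
    (ρ₀ ρ₁ : EuclideanSpace ℝ (Fin n) → ℝ)
    (hρ₀_cont : Continuous ρ₀) (hρ₁_cont : Continuous ρ₁)
    (hρ₀_nonneg : ∀ x, 0 ≤ ρ₀ x) (hρ₁_nonneg : ∀ y, 0 ≤ ρ₁ y)
    (hρ₀_int : Integrable ρ₀) (hρ₁_int : Integrable ρ₁)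
    (hmass : ∫ x, ρ₀ x = ∫ y, ρ₁ y)
    (hfin : Integrable (fun y => ρ₁ y / ∫ z, g z y * ρ₀ z)) :
    ∃ φ ψ : EuclideanSpace ℝ (Fin n) → ℝ,
      Continuous φ ∧ (∀ x, 0 ≤ φ x) ∧ Measurable ψ ∧ (∀ y, 0 ≤ ψ y) ∧
      (∀ x, φ x * ∫ y, g x y * ψ y = ρ₀ x) ∧
      (∀ᵐ y, ψ y * ∫ x, g x y * φ x = ρ₁ y) ∧
      (∀ x, φ x = 0 → ρ₀ x = 0) ∧
      (∀ᵐ y, ψ y = 0 → ρ₁ y = 0) := by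
  obtain ⟨M, hM⟩ := hg_bdd
  by_cases h0 : ∫ x, ρ₀ x = 0
  · have hρ₀ : ρ₀ = 0 := (Continuous.ae_eq_iff_eq volume hρ₀_cont continuous_zero).1
      ((integral_eq_zero_iff_of_nonneg hρ₀_nonneg hρ₀_int).1 h0)
    have hρ₁ : ρ₁ = 0 := (Continuous.ae_eq_iff_eq volume hρ₁_cont continuous_zero).1
      ((integral_eq_zero_iff_of_nonneg hρ₁_nonneg hρ₁_int).1 (hmass ▸ h0))
    exact ⟨0, 0, continuous_zero, fun _ ↦ le_rfl, measurable_zero, fun _ ↦ le_rfl,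
      by simp [hρ₀], by simp [hρ₁], by simp [hρ₀], by simp [hρ₁]⟩
  set K : EuclideanSpace ℝ (Fin n) → EuclideanSpace ℝ (Fin n) → ENNReal :=
    fun x y ↦ ENNReal.ofReal (g x y) with hKdef
  set r₀ : EuclideanSpace ℝ (Fin n) → ENNReal := fun x ↦ ENNReal.ofReal (ρ₀ x) with hr₀def
  set r₁ : EuclideanSpace ℝ (Fin n) → ENNReal := fun y ↦ ENNReal.ofReal (ρ₁ y) with hr₁def
  have hK : Measurable (Function.uncurry K) := hg_cont.measurable.ennreal_ofReal
  have hr₀ : Measurable r₀ := hρ₀_cont.measurable.ennreal_ofReal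
  have hr₁ : Measurable r₁ := hρ₁_cont.measurable.ennreal_ofReal
  have hgx : ∀ x, Continuous (g x) := fun x ↦ hg_cont.comp (Continuous.prodMk_right x)
  have hgy : ∀ y, Continuous fun x ↦ g x y := fun y ↦ hg_cont.comp (Continuous.prodMk_left y)
  have hKM : ∀ x y, K x y ≤ ENNReal.ofReal M := fun x y ↦ ENNReal.ofReal_le_ofReal (hM x y)
  have hK0 : ∀ x y, g x y ≠ 0 → K x y ≠ 0 := fun x y h ↦
    (ENNReal.ofReal_pos.2 ((hg_nonneg x y).lt_of_ne' h)).ne'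
  have hKx : ∀ x, ∀ᵐ y, K x y ≠ 0 := fun x ↦ by
    have : ∀ᵐ y, g x y ≠ 0 := by simpa [ae_iff] using hg_null_x x
    exact this.mono fun y ↦ hK0 x y
  have hKy : ∀ y, ∀ᵐ x, K x y ≠ 0 := fun y ↦ by
    have : ∀ᵐ x, g x y ≠ 0 := by simpa [ae_iff] using hg_null_y y
    exact this.mono fun x ↦ hK0 x y
  have hI₀ : ∫⁻ x, r₀ x = ENNReal.ofReal (∫ x, ρ₀ x) :=
    (ofReal_integral_eq_lintegral_ofReal hρ₀_int (ae_of_all _ hρ₀_nonneg)).symm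
  have hI₁ : ∫⁻ y, r₁ y = ENNReal.ofReal (∫ y, ρ₁ y) :=
    (ofReal_integral_eq_lintegral_ofReal hρ₁_int (ae_of_all _ hρ₁_nonneg)).symm
  have hI : ∫⁻ x, r₀ x = ∫⁻ y, r₁ y := by rw [hI₀, hI₁, hmass]
  have hI0 : ∫⁻ x, r₀ x ≠ 0 := by
    rw [hI₀]
    exact (ENNReal.ofReal_pos.2 ((integral_nonneg hρ₀_nonneg).lt_of_ne' h0)).ne'
  have hItop : ∫⁻ x, r₀ x ≠ ⊤ := hI₀ ▸ ENNReal.ofReal_ne_top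
  have hr₀top : ∀ x, r₀ x ≠ ⊤ := fun x ↦ ENNReal.ofReal_ne_top
  have hr₁top : ∀ y, r₁ y ≠ ⊤ := fun y ↦ ENNReal.ofReal_ne_top
  have hfactor_one : ∀ y,
      factor volume K r₀ r₁ 1 y = ENNReal.ofReal (ρ₁ y / ∫ z, g z y * ρ₀ z) := by
    intro y
    have hint : Integrable fun z ↦ g z y * ρ₀ z :=
      hρ₀_int.bdd_mul (hgy y).aestronglyMeasurable (c := M)
        (ae_of_all _ fun z ↦ by simpa [abs_of_nonneg (hg_nonneg z y)] using hM z y)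
    have hD : denominator volume K r₀ 1 y = ENNReal.ofReal (∫ z, g z y * ρ₀ z) := by
      rw [ofReal_integral_eq_lintegral_ofReal hint
        (ae_of_all _ fun z ↦ mul_nonneg (hg_nonneg z y) (hρ₀_nonneg z))]
      refine lintegral_congr fun z ↦ ?_
      simp [hKdef, hr₀def, ENNReal.ofReal_mul (hg_nonneg z y)]
    have hpos := denominator_ne_zero (μ := volume) hK hr₀ measurable_one le_rfl hKy hI0 y
    rw [hD] at hpos
    rw [factor, hD, ENNReal.ofReal_div_of_pos (ENNReal.ofReal_pos.1 (pos_iff_ne_zero.2 hpos))]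
  have hfin' : ∫⁻ y, factor volume K r₀ r₁ 1 y ≠ ⊤ := by
    simp only [hfactor_one]
    exact hfin.lintegral_lt_top.ne
  obtain ⟨h, hh, hh1, hfix, hDtop⟩ := exists_fixedPoint hK hr₀ hr₁ hr₀top hr₁top
    ENNReal.ofReal_ne_top hKM hKx hKy hI hI0 hItop hfin'
  have hψm := measurable_factor (μ := volume) hK hr₀ hr₁ hh
  have hψint : ∫⁻ y, factor volume K r₀ r₁ h y ≠ ⊤ :=
    ((lintegral_mono (factor_mono hh1)).trans_lt hfin'.lt_top).ne
  have hD0 := denominator_ne_zero (μ := volume) hK hr₀ hh hh1 hKy hI0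
  have hψtop : ∀ y, factor volume K r₀ r₁ h y ≠ ⊤ := fun y ↦ ENNReal.div_ne_top (hr₁top y) (hD0 y)
  have hΩ0 := fortetMap_ne_zero (ν := volume) hK hr₀ hr₁ hh hKx
    (lintegral_factor_ne_zero hK hr₀ hr₁ hh hDtop (hI ▸ hI0))
  have hΩtop : ∀ x, fortetMap volume K r₀ r₁ volume h x ≠ ⊤ := fun x ↦
    ((fortetMap_le ENNReal.ofReal_ne_top hKM x).trans_lt
      (ENNReal.mul_lt_top ENNReal.ofReal_lt_top hψint.lt_top)).ne
  have hΩ : ∀ x, ∫ y, g x y * (factor volume K r₀ r₁ h y).toReal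
      = (fortetMap volume K r₀ r₁ volume h x).toReal := fun x ↦
    integral_mul_toReal (hgx x).measurable (hg_nonneg x) hψm hψtop
  have hΩpos : ∀ x, 0 < (fortetMap volume K r₀ r₁ volume h x).toReal := fun x ↦
    ENNReal.toReal_pos (hΩ0 x) (hΩtop x)
  have hΩcont : Continuous fun x ↦ (fortetMap volume K r₀ r₁ volume h x).toReal := by
    simp only [← hΩ]
    refine continuous_of_dominated (bound := fun y ↦ M * (factor volume K r₀ r₁ h y).toReal)
      (fun x ↦ ((hgx x).measurable.mul hψm.ennreal_toReal).aestronglyMeasurable)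
      (fun x ↦ ae_of_all _ fun y ↦ ?_)
      ((integrable_toReal_of_lintegral_ne_top hψm.aemeasurable hψint).const_mul M)
      (ae_of_all _ fun y ↦ (hgy y).mul continuous_const)
    rw [Real.norm_of_nonneg (mul_nonneg (hg_nonneg x y) ENNReal.toReal_nonneg)]
    exact mul_le_mul_of_nonneg_right (hM x y) ENNReal.toReal_nonneg
  have hφ : ∀ x, ρ₀ x / (fortetMap volume K r₀ r₁ volume h x).toReal
      = (r₀ x / fortetMap volume K r₀ r₁ volume h x).toReal := fun x ↦ by
    rw [ENNReal.toReal_div, hr₀def, ENNReal.toReal_ofReal (hρ₀_nonneg x)]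
  have hD : ∀ y, ∫ x, g x y * (ρ₀ x / (fortetMap volume K r₀ r₁ volume h x).toReal)
      = (denominator volume K r₀ h y).toReal := fun y ↦ by
    simp only [hφ]
    refine (integral_mul_toReal (hgy y).measurable (fun x ↦ hg_nonneg x y)
      (hr₀.div (measurable_fortetMap hK hr₀ hr₁ hh))
      fun x ↦ ENNReal.div_ne_top (hr₀top x) (hΩ0 x)).trans ?_
    congr 1
    refine lintegral_congr_ae ?_
    filter_upwards [hfix] with x hx
    by_cases hx0 : r₀ x = 0
    · simp [hx0]
    · exact congrArg (fun t ↦ K x y * (r₀ x / t)) (hx hx0)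
  have hfirst : ∀ x, ρ₀ x / (fortetMap volume K r₀ r₁ volume h x).toReal
      * ∫ y, g x y * (factor volume K r₀ r₁ h y).toReal = ρ₀ x := fun x ↦ by
    rw [hΩ, div_mul_cancel₀ _ (hΩpos x).ne']
  have hsecond : ∀ᵐ y, (factor volume K r₀ r₁ h y).toReal
      * ∫ x, g x y * (ρ₀ x / (fortetMap volume K r₀ r₁ volume h x).toReal) = ρ₁ y := by
    filter_upwards [hDtop] with y hy
    rw [hD, ← ENNReal.toReal_mul, factor,
      ENNReal.div_mul_cancel' (fun hz ↦ absurd hz (hD0 y)) (fun ht ↦ not_not.1 fun hn ↦ hy hn ht),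
      hr₁def, ENNReal.toReal_ofReal (hρ₁_nonneg y)]
  refine ⟨fun x ↦ ρ₀ x / (fortetMap volume K r₀ r₁ volume h x).toReal,
    fun y ↦ (factor volume K r₀ r₁ h y).toReal,
    hρ₀_cont.div hΩcont fun x ↦ (hΩpos x).ne', fun x ↦ div_nonneg (hρ₀_nonneg x) (hΩpos x).le,
    hψm.ennreal_toReal, fun y ↦ ENNReal.toReal_nonneg, hfirst, hsecond,
    fun x hx ↦ (div_eq_zero_iff.1 hx).resolve_right (hΩpos x).ne', ?_⟩
  filter_upwards [hsecond] with y hy hy0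
  rw [← hy, hy0, zero_mul]
end

section
/- Pythagorean identity and optimality of the factorized coupling. Let r be a probability density on ℝⁿ × ℝⁿ (the prior joint density) and let ρ₀, ρ₁ be probability densities on ℝⁿ. Suppose a, b : ℝⁿ → [0,∞) are measurable functions such that π*(x,y) := a(x) r(x,y) b(y) is a probability density on ℝⁿ × ℝⁿ with ∫ π*(x,y) dy = ρ₀(x) a.e. and ∫ π*(x,y) dx = ρ₁(y) a.e., and assume ∫ ρ₀(x) |log a(x)| dx < ∞ and ∫ ρ₁(y) |log b(y)| dy < ∞. Then for every probability density π on ℝⁿ × ℝⁿ with marginals ∫ π(x,y) dy = ρ₀(x) and ∫ π(x,y) dx = ρ₁(y) a.e. for which D(π‖r) < ∞, one has D(π‖r) = D(π‖π*) + D(π*‖r). In particular π* minimizes D(·‖r) over all probability densities on ℝⁿ × ℝⁿ with marginals ρ₀ and ρ₁. -/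
open MeasureTheory

open Classical in
/-- Kullback–Leibler divergence `D(p‖q) = ∫ p log(p/q)` between two densities on a measure
space, defined to be `+∞` (an `EReal`) if `p` is not absolutely continuous with respect to `q`
(i.e. it is not the case that `p` vanishes a.e. where `q` vanishes) or if the integrand fails
to be integrable. -/
noncomputable def KLdiv {α : Type*} [MeasureSpace α] (p q : α → ℝ) : EReal :=
  if (∀ᵐ x, q x = 0 → p x = 0) ∧ Integrable (fun x => p x * Real.log (p x / q x)) then
    ((∫ x, p x * Real.log (p x / q x) : ℝ) : EReal)
  else ⊤

section FactorizedCoupling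

variable {α β : Type*}

theorem integrable_mul_fst_of_marginal [MeasurableSpace α] [MeasurableSpace β]
    {μ : Measure α} {ν : Measure β} [SFinite μ] [SFinite ν] {p : α × β → ℝ} {ρ g : α → ℝ}
    (hp : Integrable p (μ.prod ν)) (hp_nonneg : ∀ z, 0 ≤ p z)
    (hmarg : ∀ᵐ x ∂μ, (∫ y, p (x, y) ∂ν) = ρ x) (hg : Measurable g)
    (hρg : Integrable (fun x => ρ x * |g x|) μ) :
    Integrable (fun z => p z * g z.1) (μ.prod ν) := by
  have hmeas : AEStronglyMeasurable (fun z : α × β => p z * g z.1) (μ.prod ν) :=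
    hp.aestronglyMeasurable.mul (hg.comp measurable_fst).aestronglyMeasurable
  rw [integrable_prod_iff hmeas]
  constructor
  · filter_upwards [hp.prod_right_ae] with x hx using hx.mul_const _
  · refine hρg.congr ?_
    filter_upwards [hmarg] with x hx
    simp only [norm_mul, Real.norm_eq_abs, abs_of_nonneg (hp_nonneg _)]
    rw [integral_mul_const, hx]

theorem integral_mul_fst_of_marginal [MeasurableSpace α] [MeasurableSpace β]
    {μ : Measure α} {ν : Measure β} [SFinite μ] [SFinite ν] {p : α × β → ℝ} {ρ g : α → ℝ}
    (hpg : Integrable (fun z => p z * g z.1) (μ.prod ν))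
    (hmarg : ∀ᵐ x ∂μ, (∫ y, p (x, y) ∂ν) = ρ x) :
    ∫ z, p z * g z.1 ∂μ.prod ν = ∫ x, ρ x * g x ∂μ := by
  rw [integral_prod _ hpg]
  refine integral_congr_ae ?_
  filter_upwards [hmarg] with x hx
  rw [integral_mul_const, hx]

theorem ae_eq_zero_of_marginal_eq_zero [MeasurableSpace α] [MeasurableSpace β]
    {μ : Measure α} {ν : Measure β} [SFinite μ] [SFinite ν] {p : α × β → ℝ} {ρ g : α → ℝ}
    (hp_meas : Measurable p) (hp : Integrable p (μ.prod ν)) (hp_nonneg : ∀ z, 0 ≤ p z)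
    (hmarg : ∀ᵐ x ∂μ, (∫ y, p (x, y) ∂ν) = ρ x) (hg : Measurable g)
    (hgρ : ∀ᵐ x ∂μ, g x = 0 → ρ x = 0) :
    ∀ᵐ z ∂μ.prod ν, g z.1 = 0 → p z = 0 := by
  have hset : MeasurableSet {z : α × β | g z.1 = 0 → p z = 0} := by
    have h₁ : MeasurableSet {z : α × β | g z.1 = 0} :=
      (hg.comp measurable_fst) (measurableSet_singleton 0)
    exact h₁.imp (hp_meas (measurableSet_singleton 0))
  refine (Measure.ae_prod_iff_ae_ae hset).2 ?_
  filter_upwards [hmarg, hgρ, hp.prod_right_ae] with x hx hgx hint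
  by_cases h : g x = 0
  · have h0 := (integral_eq_zero_iff_of_nonneg (fun y => hp_nonneg (x, y)) hint).1
      (hx.trans (hgx h))
    filter_upwards [h0] with y hy _ using hy
  · exact Filter.Eventually.of_forall fun y hy => absurd hy h

theorem KLdiv_eq_integral [MeasureSpace α] {p q : α → ℝ} (hac : ∀ᵐ x, q x = 0 → p x = 0)
    (hint : Integrable (fun x => p x * Real.log (p x / q x))) :
    KLdiv p q = ((∫ x, p x * Real.log (p x / q x) : ℝ) : EReal) :=
  if_pos ⟨hac, hint⟩

theorem ac_and_integrable_of_KLdiv_lt_top [MeasureSpace α] {p q : α → ℝ}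
    (h : KLdiv p q < ⊤) :
    (∀ᵐ x, q x = 0 → p x = 0) ∧ Integrable (fun x => p x * Real.log (p x / q x)) := by
  by_contra hc
  rw [KLdiv, if_neg hc] at h
  exact lt_irrefl _ h

theorem sub_le_mul_log_div {s t : ℝ} (hs : 0 ≤ s) (ht : 0 ≤ t) (hst : t = 0 → s = 0) :
    s - t ≤ s * Real.log (s / t) := by
  rcases hs.eq_or_lt with rfl | hs
  · simpa using ht
  have ht : 0 < t := ht.lt_of_ne fun h => hs.ne' (hst h.symm)
  have h := mul_le_mul_of_nonneg_left (Real.one_sub_inv_le_log_of_pos (div_pos hs ht)) hs.le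
  have e : s * (1 - (s / t)⁻¹) = s - t := by field_simp
  linarith

/-- **Gibbs' inequality.** -/
theorem KLdiv_nonneg [MeasureSpace α] {p q : α → ℝ} (hp : Integrable p) (hq : Integrable q)
    (hp_nonneg : ∀ x, 0 ≤ p x) (hq_nonneg : ∀ x, 0 ≤ q x) (hmass : ∫ x, q x ≤ ∫ x, p x) :
    0 ≤ KLdiv p q := by
  rw [KLdiv]
  split_ifs with h
  · have hle : ∫ x, (p x - q x) ≤ ∫ x, p x * Real.log (p x / q x) := by
      refine integral_mono_ae (hp.sub hq) h.2 ?_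
      filter_upwards [h.1] with x hx using sub_le_mul_log_div (hp_nonneg x) (hq_nonneg x) hx
    rw [integral_sub hp hq] at hle
    exact_mod_cast (sub_nonneg.2 hmass).trans hle
  · exact le_top

theorem mul_log_div_eq_add {p r a b : ℝ} (ha : a = 0 → p = 0) (hb : b = 0 → p = 0)
    (hr : r = 0 → p = 0) :
    p * Real.log (p / r) =
      p * Real.log (p / (a * r * b)) + (p * Real.log a + p * Real.log b) := by
  by_cases hp : p = 0
  · simp [hp]
  have ha := mt ha hp
  have hb := mt hb hp
  have hr := mt hr hp
  rw [Real.log_div hp hr, Real.log_div hp (by positivity), Real.log_mul (by positivity) hb,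
    Real.log_mul ha hr]
  ring

end FactorizedCoupling

/-- **Pythagorean identity and optimality of the factorized coupling.** Let `r` be a prior
probability density on `ℝⁿ × ℝⁿ`, `ρ₀, ρ₁` probability densities on `ℝⁿ`, and suppose the
factorized density `π*(x,y) = a(x) r(x,y) b(y)` is a probability density with marginals
`ρ₀` and `ρ₁`, where `∫ ρ₀ |log a| < ∞` and `∫ ρ₁ |log b| < ∞`. Then every coupling `π` of
`ρ₀, ρ₁` with `D(π‖r) < ∞` satisfies `D(π‖r) = D(π‖π*) + D(π*‖r)`; in particular `π*`
minimizes `D(·‖r)` over all couplings of `ρ₀` and `ρ₁`. -/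
theorem pythagorean_identity_factorized_coupling {n : ℕ}
    (r : EuclideanSpace ℝ (Fin n) × EuclideanSpace ℝ (Fin n) → ℝ)
    (hr_meas : Measurable r) (hr_nonneg : ∀ z, 0 ≤ r z)
    (hr_int : Integrable r) (hr_mass : ∫ z, r z = 1)
    (ρ₀ ρ₁ : EuclideanSpace ℝ (Fin n) → ℝ)
    (hρ₀_meas : Measurable ρ₀) (hρ₁_meas : Measurable ρ₁)
    (hρ₀_nonneg : ∀ x, 0 ≤ ρ₀ x) (hρ₁_nonneg : ∀ y, 0 ≤ ρ₁ y)
    (hρ₀_int : Integrable ρ₀) (hρ₁_int : Integrable ρ₁)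
    (hρ₀_mass : ∫ x, ρ₀ x = 1) (hρ₁_mass : ∫ y, ρ₁ y = 1)
    (a b : EuclideanSpace ℝ (Fin n) → ℝ)
    (ha_meas : Measurable a) (hb_meas : Measurable b)
    (ha_nonneg : ∀ x, 0 ≤ a x) (hb_nonneg : ∀ y, 0 ≤ b y)
    -- π*(x,y) = a(x) r(x,y) b(y) is a probability density with marginals ρ₀ and ρ₁
    (hπs_int : Integrable (fun z => a z.1 * r z * b z.2))
    (hπs_mass : ∫ z, a z.1 * r z * b z.2 = 1)
    (hπs_marg₀ : ∀ᵐ x, (∫ y, a x * r (x, y) * b y) = ρ₀ x)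
    (hπs_marg₁ : ∀ᵐ y, (∫ x, a x * r (x, y) * b y) = ρ₁ y)
    (ha_log : Integrable (fun x => ρ₀ x * |Real.log (a x)|))
    (hb_log : Integrable (fun y => ρ₁ y * |Real.log (b y)|)) :
    ∀ π : EuclideanSpace ℝ (Fin n) × EuclideanSpace ℝ (Fin n) → ℝ,
      Measurable π → (∀ z, 0 ≤ π z) → Integrable π → (∫ z, π z = 1) →
      (∀ᵐ x, (∫ y, π (x, y)) = ρ₀ x) → (∀ᵐ y, (∫ x, π (x, y)) = ρ₁ y) →
      (KLdiv π r < ⊤ →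
        KLdiv π r = KLdiv π (fun z => a z.1 * r z * b z.2)
          + KLdiv (fun z => a z.1 * r z * b z.2) r) ∧
      KLdiv (fun z => a z.1 * r z * b z.2) r ≤ KLdiv π r := by
  set πs : EuclideanSpace ℝ (Fin n) × EuclideanSpace ℝ (Fin n) → ℝ :=
    fun z => a z.1 * r z * b z.2 with hπs
  have hπs_nonneg : ∀ z, 0 ≤ πs z := fun z =>
    mul_nonneg (mul_nonneg (ha_nonneg _) (hr_nonneg _)) (hb_nonneg _)
  have ha_zero : ∀ᵐ x, a x = 0 → ρ₀ x = 0 := by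
    filter_upwards [hπs_marg₀] with x hx h
    simpa [h] using hx.symm
  have hb_zero : ∀ᵐ y, b y = 0 → ρ₁ y = 0 := by
    filter_upwards [hπs_marg₁] with y hy h
    simpa [h] using hy.symm
  have hla : Measurable fun x => Real.log (a x) := Real.measurable_log.comp ha_meas
  have hlb : Measurable fun x => Real.log (b x) := Real.measurable_log.comp hb_meas
  have coupling_log : ∀ p : EuclideanSpace ℝ (Fin n) × EuclideanSpace ℝ (Fin n) → ℝ,
      (∀ z, 0 ≤ p z) → Integrable p →
      (∀ᵐ x, (∫ y, p (x, y)) = ρ₀ x) → (∀ᵐ y, (∫ x, p (x, y)) = ρ₁ y) →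
      Integrable (fun z => p z * Real.log (a z.1) + p z * Real.log (b z.2)) ∧
      ∫ z, (p z * Real.log (a z.1) + p z * Real.log (b z.2)) =
        (∫ x, ρ₀ x * Real.log (a x)) + ∫ y, ρ₁ y * Real.log (b y) := by
    intro p hp0 hp h₀ h₁
    have i₀ := integrable_mul_fst_of_marginal hp hp0 h₀ hla ha_log
    have i₁ := integrable_mul_fst_of_marginal hp.swap (fun z => hp0 z.swap) h₁ hlb hb_log
    have e₀ := integral_mul_fst_of_marginal (g := fun x => Real.log (a x)) i₀ h₀
    have e₁ := integral_mul_fst_of_marginal (g := fun y => Real.log (b y)) i₁ h₁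
    have i₁' := i₁.swap
    have e₁' := integral_prod_swap
      (μ := (volume : Measure (EuclideanSpace ℝ (Fin n))))
      (ν := (volume : Measure (EuclideanSpace ℝ (Fin n))))
      fun z => p z.swap * Real.log (b z.1)
    refine ⟨i₀.add i₁', ?_⟩
    refine (integral_add i₀ i₁').trans ?_
    exact congrArg₂ (· + ·) e₀ (e₁'.trans e₁)
  intro π hπ_meas hπ_nonneg hπ_int hπ_mass hπ_marg₀ hπ_marg₁
  have pythagoras : KLdiv π r < ⊤ → KLdiv π r = KLdiv π πs + KLdiv πs r := by
    intro hlt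
    obtain ⟨hac, hint⟩ := ac_and_integrable_of_KLdiv_lt_top hlt
    obtain ⟨iπ, eπ⟩ := coupling_log π hπ_nonneg hπ_int hπ_marg₀ hπ_marg₁
    obtain ⟨is, es⟩ := coupling_log πs hπs_nonneg hπs_int hπs_marg₀ hπs_marg₁
    have ha_π : ∀ᵐ z : EuclideanSpace ℝ (Fin n) × EuclideanSpace ℝ (Fin n),
        a z.1 = 0 → π z = 0 :=
      ae_eq_zero_of_marginal_eq_zero hπ_meas hπ_int hπ_nonneg hπ_marg₀ ha_meas ha_zero
    have hb_π : ∀ᵐ z : EuclideanSpace ℝ (Fin n) × EuclideanSpace ℝ (Fin n),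
        b z.2 = 0 → π z = 0 :=
      Measure.measurePreserving_swap.quasiMeasurePreserving.ae
        (ae_eq_zero_of_marginal_eq_zero (hπ_meas.comp measurable_swap) hπ_int.swap
          (fun z => hπ_nonneg z.swap) hπ_marg₁ hb_meas hb_zero)
    have hac_πs : ∀ᵐ z, πs z = 0 → π z = 0 := by
      filter_upwards [ha_π, hb_π, hac] with z h₁ h₂ h₃ h
      rcases mul_eq_zero.1 h with h | h
      · exact (mul_eq_zero.1 h).elim h₁ h₃
      · exact h₂ h
    have split_π : (fun z => π z * Real.log (π z / r z)) =ᵐ[volume] fun z =>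
        π z * Real.log (π z / πs z) + (π z * Real.log (a z.1) + π z * Real.log (b z.2)) := by
      filter_upwards [ha_π, hb_π, hac] with z h₁ h₂ h₃ using mul_log_div_eq_add h₁ h₂ h₃
    have split_πs : (fun z => πs z * Real.log (πs z / r z)) = fun z =>
        πs z * Real.log (a z.1) + πs z * Real.log (b z.2) := by
      funext z
      have h := mul_log_div_eq_add (p := πs z) (r := r z) (a := a z.1) (b := b z.2)
        (fun h => by simp [hπs, h]) (fun h => by simp [hπs, h]) (fun h => by simp [hπs, h])
      have h_one : πs z * Real.log (πs z / (a z.1 * r z * b z.2)) = 0 := by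
        change πs z * Real.log (πs z / πs z) = 0
        by_cases h0 : πs z = 0 <;> simp [h0]
      rw [h, h_one, zero_add]
    have hint_πs : Integrable fun z => π z * Real.log (π z / πs z) := by
      refine (hint.sub iπ).congr ?_
      filter_upwards [split_π] with z hz
      simp only [Pi.sub_apply]
      linarith
    rw [KLdiv_eq_integral hac hint, KLdiv_eq_integral hac_πs hint_πs,
      KLdiv_eq_integral (.of_forall fun z h => by simp [hπs, h]) (split_πs ▸ is),
      integral_congr_ae split_π, integral_add hint_πs iπ, split_πs, eπ, es]
    exact EReal.coe_add _ _
  refine ⟨pythagoras, ?_⟩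
  rcases eq_top_or_lt_top (KLdiv π r) with h | h
  · exact h ▸ le_top
  · rw [pythagoras h]
    exact le_add_of_nonneg_left (KLdiv_nonneg hπ_int hπs_int hπ_nonneg hπs_nonneg
      (hπs_mass.trans hπ_mass.symm).le)
end

section
/- Product of a backward and a forward heat solution satisfies the Fokker–Planck equation. Let γ > 0 and let φ, φ̂ : (0,1) × ℝⁿ → ℝ be functions that are continuously differentiable in t and twice continuously differentiable in x, with φ(t,x) > 0 everywhere, such that ∂φ/∂t + (γ/2) Δφ = 0 and ∂φ̂/∂t = (γ/2) Δφ̂ on (0,1) × ℝⁿ. Define ρ(t,x) := φ(t,x) φ̂(t,x) and the drift field b(t,x) := γ ∇ₓφ(t,x)/φ(t,x). Then ρ satisfies the Fokker–Planck equation ∂ρ/∂t + ∇·(b ρ) − (γ/2) Δρ = 0 on (0,1) × ℝⁿ, where ∇· denotes the spatial divergence Σᵢ ∂/∂x_i and Δ the spatial Laplacian Σᵢ ∂²/∂x_i². -/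
open MeasureTheory

/-- Partial derivative in the time variable of a function of time and space. -/
noncomputable def pdt {n : ℕ} (f : ℝ → EuclideanSpace ℝ (Fin n) → ℝ) (t : ℝ)
    (x : EuclideanSpace ℝ (Fin n)) : ℝ :=
  deriv (fun s => f s x) t

/-- `i`-th partial derivative in the space variables: `∂f/∂x_i (x)`. -/
noncomputable def pdx {n : ℕ} (i : Fin n) (f : EuclideanSpace ℝ (Fin n) → ℝ)
    (x : EuclideanSpace ℝ (Fin n)) : ℝ :=
  deriv (fun s : ℝ => f (x + s • EuclideanSpace.single i (1 : ℝ))) 0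

/-- `i`-th second partial derivative in the space variables: `∂²f/∂x_i² (x)`. -/
noncomputable def pdx2 {n : ℕ} (i : Fin n) (f : EuclideanSpace ℝ (Fin n) → ℝ)
    (x : EuclideanSpace ℝ (Fin n)) : ℝ :=
  iteratedDeriv 2 (fun s : ℝ => f (x + s • EuclideanSpace.single i (1 : ℝ))) 0

theorem pdx_add_smul_single {n : ℕ} (i : Fin n) (f : EuclideanSpace ℝ (Fin n) → ℝ)
    (x : EuclideanSpace ℝ (Fin n)) (s : ℝ) :
    pdx i f (x + s • EuclideanSpace.single i (1 : ℝ)) =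
      deriv (fun r : ℝ => f (x + r • EuclideanSpace.single i (1 : ℝ))) s := by
  have h := deriv_comp_const_add
    (fun r : ℝ => f (x + r • EuclideanSpace.single i (1 : ℝ))) s 0
  simpa [pdx, add_smul, add_assoc] using h

theorem iteratedDeriv_two_mul {g h : ℝ → ℝ} (hg : ContDiff ℝ 2 g) (hh : ContDiff ℝ 2 h)
    (s : ℝ) :
    iteratedDeriv 2 (fun r => g r * h r) s =
      iteratedDeriv 2 g s * h s + 2 * (deriv g s * deriv h s) + g s * iteratedDeriv 2 h s := by
  have hg₁ := hg.differentiable two_ne_zero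
  have hh₁ := hh.differentiable two_ne_zero
  have hg₂ : Differentiable ℝ (deriv g) := hg.differentiable_deriv_two
  have hh₂ : Differentiable ℝ (deriv h) := hh.differentiable_deriv_two
  have hderiv : deriv (fun r => g r * h r) = fun r => deriv g r * h r + g r * deriv h r :=
    funext fun r => deriv_fun_mul (hg₁ r) (hh₁ r)
  simp only [iteratedDeriv_succ, iteratedDeriv_zero, hderiv]
  rw [deriv_fun_add ((hg₂ s).fun_mul (hh₁ s)) ((hg₁ s).fun_mul (hh₂ s)),
    deriv_fun_mul (hg₂ s) (hh₁ s), deriv_fun_mul (hg₁ s) (hh₂ s)]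
  ring

theorem contDiff_comp_add_smul_single {n : ℕ} (i : Fin n) {f : EuclideanSpace ℝ (Fin n) → ℝ}
    (hf : ContDiff ℝ 2 f) (x : EuclideanSpace ℝ (Fin n)) :
    ContDiff ℝ 2 (fun s : ℝ => f (x + s • EuclideanSpace.single i (1 : ℝ))) :=
  hf.comp (contDiff_const.add (contDiff_id.smul contDiff_const))

theorem pdx2_mul {n : ℕ} (i : Fin n) {f g : EuclideanSpace ℝ (Fin n) → ℝ}
    (hf : ContDiff ℝ 2 f) (hg : ContDiff ℝ 2 g) (x : EuclideanSpace ℝ (Fin n)) :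
    pdx2 i (fun y => f y * g y) x =
      pdx2 i f x * g x + 2 * (pdx i f x * pdx i g x) + f x * pdx2 i g x := by
  simpa [pdx2, pdx] using iteratedDeriv_two_mul (contDiff_comp_add_smul_single i hf x)
    (contDiff_comp_add_smul_single i hg x) 0

theorem pdx_const_mul_pdx_mul {n : ℕ} (i : Fin n) (c : ℝ)
    {f g : EuclideanSpace ℝ (Fin n) → ℝ} (hf : ContDiff ℝ 2 f) (hg : ContDiff ℝ 2 g)
    (x : EuclideanSpace ℝ (Fin n)) :
    pdx i (fun y => c * (pdx i f y * g y)) x =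
      c * (pdx2 i f x * g x + pdx i f x * pdx i g x) := by
  have hf' := (contDiff_comp_add_smul_single i hf x).differentiable_deriv_two 0
  have hg' := (contDiff_comp_add_smul_single i hg x).differentiable two_ne_zero 0
  rw [pdx]
  simp only [pdx_add_smul_single]
  rw [deriv_const_mul _ (hf'.fun_mul hg'), deriv_fun_mul hf' hg']
  simp [pdx, pdx2, iteratedDeriv_succ]

/-- **Product of a backward and a forward heat solution satisfies the Fokker–Planck
equation.** If `φ > 0` solves the backward equation `∂φ/∂t + (γ/2)Δφ = 0` and `φ̂` solves
the forward equation `∂φ̂/∂t = (γ/2)Δφ̂` on `(0,1) × ℝⁿ`, both being C¹ in time and C² in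
space, then `ρ = φ φ̂` with drift `b = γ ∇φ/φ` satisfies
`∂ρ/∂t + ∇·(bρ) − (γ/2)Δρ = 0` on `(0,1) × ℝⁿ`. -/
theorem product_solves_fokker_planck {n : ℕ} (γ : ℝ) (hγ : 0 < γ)
    (φ φhat : ℝ → EuclideanSpace ℝ (Fin n) → ℝ)
    (hφ_pos : ∀ t ∈ Set.Ioo (0 : ℝ) 1, ∀ x, 0 < φ t x)
    -- continuously differentiable in t
    (hφ_t : ∀ x, ContDiffOn ℝ 1 (fun t => φ t x) (Set.Ioo (0 : ℝ) 1))
    (hφhat_t : ∀ x, ContDiffOn ℝ 1 (fun t => φhat t x) (Set.Ioo (0 : ℝ) 1))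
    -- twice continuously differentiable in x
    (hφ_x : ∀ t ∈ Set.Ioo (0 : ℝ) 1, ContDiff ℝ 2 (φ t))
    (hφhat_x : ∀ t ∈ Set.Ioo (0 : ℝ) 1, ContDiff ℝ 2 (φhat t))
    -- backward heat equation for φ
    (hbackward : ∀ t ∈ Set.Ioo (0 : ℝ) 1, ∀ x,
      pdt φ t x + (γ / 2) * ∑ i : Fin n, pdx2 i (φ t) x = 0)
    -- forward heat equation for φ̂
    (hforward : ∀ t ∈ Set.Ioo (0 : ℝ) 1, ∀ x,
      pdt φhat t x = (γ / 2) * ∑ i : Fin n, pdx2 i (φhat t) x) :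
    ∀ t ∈ Set.Ioo (0 : ℝ) 1, ∀ x,
      pdt (fun s y => φ s y * φhat s y) t x
        + (∑ i : Fin n, pdx i
            (fun y => (γ * pdx i (φ t) y / φ t y) * (φ t y * φhat t y)) x)
        - (γ / 2) * ∑ i : Fin n, pdx2 i (fun y => φ t y * φhat t y) x
        = 0 := by
  intro t ht x
  have hnhds : Set.Ioo (0 : ℝ) 1 ∈ nhds t := isOpen_Ioo.mem_nhds ht
  have htime : pdt (fun s y => φ s y * φhat s y) t x =
      pdt φ t x * φhat t x + φ t x * pdt φhat t x :=
    deriv_fun_mul (((hφ_t x).contDiffAt hnhds).differentiableAt one_ne_zero)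
      (((hφhat_t x).contDiffAt hnhds).differentiableAt one_ne_zero)
  have hflux (i : Fin n) :
      (fun y => (γ * pdx i (φ t) y / φ t y) * (φ t y * φhat t y)) =
        fun y => γ * (pdx i (φ t) y * φhat t y) := by
    funext y
    have := (hφ_pos t ht y).ne'
    field_simp
  simp only [htime, hflux, pdx_const_mul_pdx_mul _ γ (hφ_x t ht) (hφhat_x t ht),
    pdx2_mul _ (hφ_x t ht) (hφhat_x t ht), Finset.sum_add_distrib, ← Finset.mul_sum,
    ← Finset.sum_mul]
  linear_combination φhat t x * hbackward t ht x + φ t x * hforward t ht x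
end
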